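/- (Theorem 2: necessary condition on admissible perturbation signals.) Consider N agents running the perturbed algorithm (12) over a weight-balanced weighted digraph with stepsize Δ ∈ (0,2) and initialization Σ_{i=1}^N v^i(0) = 0. If average consensus is preserved, i.e., x^i(k) → r^avg as k → ∞ for every agent i, then necessarily lim_{k→∞} Σ_{i=1}^N Σ_{m=0}^{k} (1−Δ)^{k−m}·f^i(m) = 0. -/

import Mathlib

/-- Weighted differences sum to zero over a weight-balanced digraph. -/
theorem sum_sum_mul_sub_eq_zero_of_balanced {ι : Type*} [Fintype ι] {a : ι → ι → ℝ}
    (hbal : ∀ i, ∑ j, a i j = ∑ j, a j i) (x : ι → ℝ) :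
    ∑ i, ∑ j, a i j * (x i - x j) = 0 := by
  simp only [mul_sub, Finset.sum_sub_distrib]
  rw [Finset.sum_comm (f := fun i j => a i j * x j), ← Finset.sum_sub_distrib]
  refine Finset.sum_eq_zero fun i _ => ?_
  rw [← Finset.sum_mul, ← Finset.sum_mul, hbal i, sub_self]

/-- Variation of constants for a scalar affine recursion. -/
theorem affine_recursion_solution {c d : ℝ} {y F : ℕ → ℝ}
    (h : ∀ k, y (k + 1) = c * y k + d * F k) (k : ℕ) :
    y (k + 1) = c ^ (k + 1) * y 0 + d * ∑ m ∈ Finset.range (k + 1), c ^ (k - m) * F m := by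
  induction k with
  | zero => simp [h 0]
  | succ k ih =>
    have hsum : ∑ m ∈ Finset.range (k + 1), c ^ (k + 1 - m) * F m =
        c * ∑ m ∈ Finset.range (k + 1), c ^ (k - m) * F m := by
      rw [Finset.mul_sum]
      refine Finset.sum_congr rfl fun m hm => ?_
      rw [Nat.sub_add_comm (Nat.lt_succ_iff.mp (Finset.mem_range.mp hm)), pow_succ]
      ring
    rw [h (k + 1), ih, Finset.sum_range_succ _ (k + 1), hsum, Nat.sub_self]
    ring


/-- Theorem 2 (necessary condition on admissible perturbation signals): if the
perturbed algorithm (12) over a weight-balanced digraph with `Δ ∈ (0,2)` and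
`Σ v^i(0) = 0` still reaches average consensus, then
`Σ_i Σ_{m=0}^{k} (1−Δ)^{kided−m} f^i(m) → 0`. -/
theorem stmt9 (N : ℕ) (hN : 0 < N) (a : Fin N → Fin N → ℝ) (Δ : ℝ)
    (hΔ0 : 0 < Δ) (hΔ2 : Δ < 2)
    (r : Fin N → ℝ) (f : Fin N → ℕ → ℝ) (v x : ℕ → Fin N → ℝ)
    (ha_nonneg : ∀ i j, 0 ≤ a i j) (ha_diag : ∀ i, a i i = 0)
    (hbal : ∀ i, ∑ j, a i j = ∑ j, a j i)
    (hv0 : ∑ i, v 0 i = 0)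
    (hv : ∀ k i, v (k + 1) i = v k i + Δ * ∑ j, a i j * (x k i - x k j))
    (hx : ∀ k i, x (k + 1) i =
      x k i + Δ * (-(x k i - r i) - (∑ j, a i j * (x k i - x k j)) - v k i + f i k))
    (hconv : ∀ i, Filter.Tendsto (fun k => x k i) Filter.atTop
      (nhds ((1 / (N : ℝ)) * ∑ i, r i))) :
    Filter.Tendsto
      (fun k => ∑ i, ∑ m ∈ Finset.range (k + 1), (1 - Δ) ^ (k - m) * f i m)
      Filter.atTop (nhds 0) := by
  have hN0 : (N : ℝ) ≠ 0 := by positivity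
  have hvsum : ∀ k, ∑ i, v k i = 0 := by
    intro k
    induction k with
    | zero => exact hv0
    | succ k ih =>
      simp only [hv, Finset.sum_add_distrib, ← Finset.mul_sum, ih,
        sum_sum_mul_sub_eq_zero_of_balanced hbal, mul_zero, add_zero]
  have hrec : ∀ k, ∑ i, x (k + 1) i - ∑ i, r i =
      (1 - Δ) * (∑ i, x k i - ∑ i, r i) + Δ * ∑ i, f i k := by
    intro k
    simp only [hx, Finset.sum_add_distrib, Finset.sum_sub_distrib, Finset.sum_neg_distrib,
      ← Finset.mul_sum, hvsum, sum_sum_mul_sub_eq_zero_of_balanced hbal]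
    ring
  have hy : Filter.Tendsto (fun k => ∑ i, x k i - ∑ i, r i) Filter.atTop (nhds 0) := by
    have h := (tendsto_finsetSum Finset.univ fun i _ => hconv i).sub_const (∑ i, r i)
    rwa [Finset.sum_const, Finset.card_univ, Fintype.card_fin, nsmul_eq_mul, ← mul_assoc,
      mul_one_div_cancel hN0, one_mul, sub_self] at h
  have hpow : Filter.Tendsto (fun k : ℕ => (1 - Δ) ^ k) Filter.atTop (nhds 0) :=
    tendsto_pow_atTop_nhds_zero_of_abs_lt_one (abs_lt.mpr ⟨by linarith, by linarith⟩)
  have hlim := (((hy.sub (hpow.mul_const (∑ i, x 0 i - ∑ i, r i))).comp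
    (Filter.tendsto_add_atTop_nat 1)).const_mul Δ⁻¹)
  rw [zero_mul, sub_zero, mul_zero] at hlim
  refine hlim.congr fun k => ?_
  have hsol := affine_recursion_solution
    (y := fun k => ∑ i, x k i - ∑ i, r i) (F := fun k => ∑ i, f i k) hrec k
  simp only [Function.comp_apply] at hsol ⊢
  rw [hsol, add_sub_cancel_left, inv_mul_cancel_left₀ hΔ0.ne', Finset.sum_comm]
  simp only [Finset.mul_sum]
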